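/- arXiv:2304.01465 — 2 statements merged into one kernel-verified Lean document; each statement's English description precedes it below -/
import Mathlib

section
/- Let f : 𝔻 → ℂ be harmonic (f = h + conj(g) with h, g holomorphic) and K-quasiregular, i.e., (|h'(z)| + |g'(z)|)² ≤ K(|h'(z)|² - |g'(z)|²) for all z ∈ 𝔻 with K ≥ 1, and suppose f maps 𝔻 into 𝔻. Then for all z ∈ 𝔻, |h'(z)| + |g'(z)| ≤ K·(1 - |f(z)|²)/(1 - |z|²). -/
open Metric ComplexConjugate

lemma Complex.re_nonpos_of_re_nonpos_on_sphere {Ψ : ℂ → ℂ} {R : ℝ} (hR : 0 < R)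
    (hΨ : DifferentiableOn ℂ Ψ (closedBall (0 : ℂ) R))
    (hs : ∀ w ∈ sphere (0 : ℂ) R, (Ψ w).re ≤ 0) : (Ψ 0).re ≤ 0 := by
  have hd : DiffContOnCl ℂ (fun w => Complex.exp (Ψ w)) (ball 0 R) := by
    apply DifferentiableOn.diffContOnCl
    rw [closure_ball _ hR.ne']
    exact hΨ.cexp
  have h := Complex.norm_le_of_forall_mem_frontier_norm_le isBounded_ball hd (C := 1)
    (fun w hw => by
      rw [frontier_ball _ hR.ne'] at hw
      simpa [Complex.norm_exp] using hs w hw)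
    (subset_closure (mem_ball_self hR))
  simpa [Complex.norm_exp] using h

/-- Harmonic Schwarz lemma at the center of the disk: an extremal-functional estimate comparing
`h + conj g` with the Blaschke factor taking the same value at `0`. -/
lemma re_deriv_add_sq_mul_deriv_le {h g : ℂ → ℂ}
    (hh : DifferentiableOn ℂ h (closedBall (0 : ℂ) 1))
    (hg : DifferentiableOn ℂ g (closedBall (0 : ℂ) 1))
    (hs : ∀ w ∈ sphere (0 : ℂ) 1, ‖h w + conj (g w)‖ ≤ 1) :
    (deriv h 0 + (h 0 + conj (g 0)) ^ 2 * deriv g 0).re ≤ 1 - ‖h 0 + conj (g 0)‖ ^ 2 := by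
  set a := h 0 + conj (g 0) with ha
  have hmem : closedBall (0 : ℂ) 1 ∈ nhds 0 := closedBall_mem_nhds _ one_pos
  have hdh := (Complex.differentiableOn_dslope hmem).2 hh
  have hdg := (Complex.differentiableOn_dslope hmem).2 hg
  have key := Complex.re_nonpos_of_re_nonpos_on_sphere (R := 1)
    (Ψ := fun w => h w * (2 * conj a + conj a ^ 2 * w) + dslope h 0 w + conj (h 0) * w
      + g w * (2 * a + w) + a ^ 2 * dslope g 0 w + conj (a ^ 2 * g 0) * w
      - (1 + a * conj a) - 2 * conj a * w) one_pos (by fun_prop) (fun w hw => by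
    have hw1 : ‖w‖ = 1 := by simpa using hw
    have hw0 : w ≠ 0 := by rintro rfl; simp at hw1
    have hww : w * conj w = 1 := by simp [Complex.mul_conj, Complex.normSq_eq_norm_sq, hw1]
    have hinv : w⁻¹ = conj w := inv_eq_of_mul_eq_one_right hww
    have hslope (u : ℂ → ℂ) : dslope u 0 w = conj w * (u w - u 0) := by
      rw [dslope_of_ne _ hw0, slope_def_field, sub_zero, ← hinv]; field_simp
    have hP : ((h w + conj (g w)) * (conj w * (1 + conj a * w) ^ 2)).re
        ≤ ‖1 + conj a * w‖ ^ 2 := by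
      refine (Complex.re_le_norm _).trans ?_
      rw [norm_mul, norm_mul, norm_pow, Complex.norm_conj, hw1, one_mul]
      exact mul_le_of_le_one_left (sq_nonneg _) (hs w hw)
    have hexp : conj w * (1 + conj a * w) ^ 2 = conj w + 2 * conj a + conj a ^ 2 * w := by
      linear_combination (2 * conj a + conj a ^ 2 * w) * hww
    have hnorm : ‖1 + conj a * w‖ ^ 2 = (1 + a * conj a + 2 * conj a * w).re := by
      have hw2 : w.re ^ 2 + w.im ^ 2 = 1 := by
        have := Complex.sq_norm w
        rw [hw1, Complex.normSq_apply] at this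
        linarith
      rw [Complex.sq_norm, Complex.normSq_apply]
      simp
      linear_combination (a.re ^ 2 + a.im ^ 2) * hw2
    rw [hexp, hnorm] at hP
    simp only [hslope]
    refine le_of_eq_of_le ?_ (sub_nonpos.2 hP)
    clear_value a
    simp [pow_two]
    ring)
  have hre : (h 0 * (2 * conj a) + g 0 * (2 * a)).re = 2 * ‖a‖ ^ 2 := by
    rw [Complex.sq_norm, Complex.normSq_apply]
    simp [ha]
    ring
  have hn : (a * conj a).re = ‖a‖ ^ 2 := by
    rw [Complex.sq_norm, Complex.normSq_apply]
    simp
  simp only [dslope_same, mul_zero, add_zero, sub_zero, Complex.add_re, Complex.sub_re,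
    Complex.one_re] at key hre ⊢
  linarith

lemma mobius_denom_ne_zero_and_norm_lt_one {z u : ℂ} (hz : ‖z‖ < 1) (hu : ‖u‖ < 1) :
    1 + conj z * u ≠ 0 ∧ ‖(u + z) / (1 + conj z * u)‖ < 1 := by
  have hne : 1 + conj z * u ≠ 0 := by
    intro h0
    have h1 : ‖conj z * u‖ = 1 := by
      rw [eq_neg_of_add_eq_zero_right h0]; simp
    rw [norm_mul, Complex.norm_conj] at h1
    nlinarith [norm_nonneg z, norm_nonneg u]
  refine ⟨hne, ?_⟩
  rw [norm_div, div_lt_one (norm_pos_iff.2 hne), ← sq_lt_sq₀ (norm_nonneg _) (norm_nonneg _)]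
  have h2 : ‖1 + conj z * u‖ ^ 2 - ‖u + z‖ ^ 2 = (1 - ‖z‖ ^ 2) * (1 - ‖u‖ ^ 2) := by
    simp only [Complex.sq_norm, Complex.normSq_apply]
    simp
    ring
  have hz' : 0 < 1 - ‖z‖ ^ 2 := by nlinarith [norm_nonneg z]
  have hu' : 0 < 1 - ‖u‖ ^ 2 := by nlinarith [norm_nonneg u]
  nlinarith [mul_pos hz' hu']

lemma re_mul_deriv_add_sq_mul_deriv_le {h g : ℂ → ℂ}
    (hh : DifferentiableOn ℂ h (ball (0 : ℂ) 1))
    (hg : DifferentiableOn ℂ g (ball (0 : ℂ) 1))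
    (hs : ∀ z ∈ ball (0 : ℂ) 1, ‖h z + conj (g z)‖ ≤ 1)
    {z ρ : ℂ} (hz : ‖z‖ < 1) (hρ : ‖ρ‖ < 1) :
    (ρ * (deriv h z + (h z + conj (g z)) ^ 2 * deriv g z)).re * (1 - ‖z‖ ^ 2)
      ≤ 1 - ‖h z + conj (g z)‖ ^ 2 := by
  set φ : ℂ → ℂ := fun w => (ρ * w + z) / (1 + conj z * (ρ * w)) with hφ
  have hball (w) (hw : w ∈ closedBall (0 : ℂ) 1) : ‖ρ * w‖ < 1 := by
    rw [norm_mul]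
    have : ‖w‖ ≤ 1 := by simpa using hw
    exact (mul_le_of_le_one_right (norm_nonneg _) this).trans_lt hρ
  have hmaps : Set.MapsTo φ (closedBall 0 1) (ball 0 1) := fun w hw => by
    rw [mem_ball_zero_iff]
    exact (mobius_denom_ne_zero_and_norm_lt_one hz (hball w hw)).2
  have hdφ : DifferentiableOn ℂ φ (closedBall 0 1) := by
    refine DifferentiableOn.div (by fun_prop) (by fun_prop) fun w hw => ?_
    exact (mobius_denom_ne_zero_and_norm_lt_one hz (hball w hw)).1
  have hφ0 : φ 0 = z := by simp [hφ]
  have hφ' : HasDerivAt φ (ρ * (1 - ‖z‖ ^ 2 : ℝ)) 0 := by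
    have h1 : HasDerivAt (fun w => ρ * w + z) ρ 0 := by
      simpa using ((hasDerivAt_id (0 : ℂ)).const_mul ρ).add_const z
    have h2 : HasDerivAt (fun w => 1 + conj z * (ρ * w)) (conj z * ρ) 0 := by
      simpa using (((hasDerivAt_id (0 : ℂ)).const_mul ρ).const_mul (conj z)).const_add 1
    refine (h1.div h2 (by simp)).congr_deriv ?_
    have : ((‖z‖ ^ 2 : ℝ) : ℂ) = z * conj z := by
      rw [Complex.mul_conj, Complex.normSq_eq_norm_sq]
    rw [Complex.ofReal_sub, this]
    simp
    ring
  have hcomp {u : ℂ → ℂ} (hu : DifferentiableOn ℂ u (ball (0 : ℂ) 1)) :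
      deriv (u ∘ φ) 0 = deriv u z * (ρ * (1 - ‖z‖ ^ 2 : ℝ)) := by
    have h1 : HasDerivAt u (deriv u z) (φ 0) := by
      rw [hφ0]
      exact (hu.differentiableAt (isOpen_ball.mem_nhds (by simpa using hz))).hasDerivAt
    exact (h1.comp 0 hφ').deriv
  have key := re_deriv_add_sq_mul_deriv_le (hh.comp hdφ hmaps) (hg.comp hdφ hmaps)
    fun w hw => hs _ (hmaps (sphere_subset_closedBall hw))
  rw [hcomp hh, hcomp hg] at key
  simp only [Function.comp_apply, hφ0] at key
  rw [← Complex.re_mul_ofReal]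
  convert key using 2
  ring

/-- Schwarz–Pick inequality for harmonic self-maps of the disk. -/
lemma norm_deriv_add_sq_mul_deriv_le {h g : ℂ → ℂ}
    (hh : DifferentiableOn ℂ h (ball (0 : ℂ) 1))
    (hg : DifferentiableOn ℂ g (ball (0 : ℂ) 1))
    (hs : ∀ z ∈ ball (0 : ℂ) 1, ‖h z + conj (g z)‖ ≤ 1) {z : ℂ} (hz : ‖z‖ < 1) :
    ‖deriv h z + (h z + conj (g z)) ^ 2 * deriv g z‖ * (1 - ‖z‖ ^ 2)
      ≤ 1 - ‖h z + conj (g z)‖ ^ 2 := by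
  set A := deriv h z + (h z + conj (g z)) ^ 2 * deriv g z with hA
  obtain ⟨c, hc, hcA⟩ : ∃ c : ℂ, ‖c‖ = 1 ∧ c * A = ‖A‖ := by
    rcases eq_or_ne A 0 with h0 | h0
    · exact ⟨1, by simp, by simp [h0]⟩
    · have hn : (‖A‖ : ℂ) ≠ 0 := by simpa using h0
      refine ⟨‖A‖ / A, ?_, by field_simp⟩
      rw [norm_div, Complex.norm_real, norm_norm, div_self (by simpa using h0)]
  have hr (r : ℝ) (hr : r ∈ Set.Ico (0 : ℝ) 1) :
      r * (‖A‖ * (1 - ‖z‖ ^ 2)) ≤ 1 - ‖h z + conj (g z)‖ ^ 2 := by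
    have := re_mul_deriv_add_sq_mul_deriv_le hh hg hs hz (ρ := r * c)
      (by simpa [hc, abs_of_nonneg hr.1] using hr.2)
    rwa [← hA, mul_assoc, hcA, ← Complex.ofReal_mul, Complex.ofReal_re, mul_assoc] at this
  have hclos : (1 : ℝ) ∈ closure (Set.Ico (0 : ℝ) 1) := by
    rw [closure_Ico zero_ne_one]; simp
  have := le_on_closure hr (by fun_prop) (by fun_prop) hclos
  simpa using this

theorem stmt6 (K : ℝ) (hK : 1 ≤ K) (h g : ℂ → ℂ)
    (hh : DifferentiableOn ℂ h (ball (0:ℂ) 1))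
    (hg : DifferentiableOn ℂ g (ball (0:ℂ) 1))
    (hJ : ∀ z ∈ ball (0:ℂ) 1, ‖deriv g z‖ < ‖deriv h z‖)
    (hqr : ∀ z ∈ ball (0:ℂ) 1,
      (‖deriv h z‖ + ‖deriv g z‖) ^ 2 ≤ K * (‖deriv h z‖ ^ 2 - ‖deriv g z‖ ^ 2))
    (hmaps : ∀ z ∈ ball (0:ℂ) 1, ‖h z + conj (g z)‖ < 1) :
    ∀ z ∈ ball (0:ℂ) 1,
      ‖deriv h z‖ + ‖deriv g z‖ ≤
        K * (1 - ‖h z + conj (g z)‖ ^ 2) / (1 - ‖z‖ ^ 2) := by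
  intro z hz
  have hz1 : ‖z‖ < 1 := by simpa using hz
  have hz2 : 0 < 1 - ‖z‖ ^ 2 := by nlinarith [norm_nonneg z]
  have hpos : 0 < ‖deriv h z‖ + ‖deriv g z‖ := by
    linarith [hJ z hz, norm_nonneg (deriv g z)]
  have hqr' : ‖deriv h z‖ + ‖deriv g z‖ ≤ K * (‖deriv h z‖ - ‖deriv g z‖) := by
    refine le_of_mul_le_mul_right ?_ hpos
    linarith [hqr z hz]
  have hle : ‖deriv h z‖ - ‖deriv g z‖
      ≤ ‖deriv h z + (h z + conj (g z)) ^ 2 * deriv g z‖ := by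
    have h1 : ‖(h z + conj (g z)) ^ 2 * deriv g z‖ ≤ ‖deriv g z‖ := by
      rw [norm_mul, norm_pow]
      exact mul_le_of_le_one_left (norm_nonneg _)
        (pow_le_one₀ (norm_nonneg _) (hmaps z hz).le)
    have h2 := norm_sub_le_norm_add (deriv h z) ((h z + conj (g z)) ^ 2 * deriv g z)
    linarith
  have hSP := norm_deriv_add_sq_mul_deriv_le hh hg (fun w hw => (hmaps w hw).le) hz1
  rw [le_div_iff₀ hz2]
  calc (‖deriv h z‖ + ‖deriv g z‖) * (1 - ‖z‖ ^ 2)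
      ≤ K * (‖deriv h z‖ - ‖deriv g z‖) * (1 - ‖z‖ ^ 2) := by gcongr
    _ = K * ((‖deriv h z‖ - ‖deriv g z‖) * (1 - ‖z‖ ^ 2)) := by ring
    _ ≤ K * (1 - ‖h z + conj (g z)‖ ^ 2) := by
        gcongr
        exact (mul_le_mul_of_nonneg_right hle hz2.le).trans hSP
end

section
/- Let ω be a majorant satisfying: there is M > 0 with δ∫_δ^π ω(t)/t² dt ≤ Mω(δ) for all δ ∈ (0,π]. If φ : 𝕋 → ℂ is continuous and |φ(ξ₁) - φ(ξ₂)| ≤ L·ω(|ξ₁ - ξ₂|) for all ξ₁, ξ₂ ∈ 𝕋, then the Poisson extension P[φ] satisfies |P[φ](z₁) - P[φ](z₂)| ≤ M'·ω(|z₁ - z₂|) for all z₁, z₂ in the closed unit disk, for some constant M' > 0. -/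
open Metric Real

def IsMajorant (ω : ℝ → ℝ) : Prop :=
  ContinuousOn ω (Set.Ici 0) ∧ MonotoneOn ω (Set.Ici 0) ∧ ω 0 = 0 ∧
  ∀ s t : ℝ, 0 < s → s ≤ t → ω t / t ≤ ω s / s

/-- The Poisson extension of a (complex-valued) boundary function `φ` to the
closed unit disk: the Poisson integral inside and `φ` itself on the boundary. -/
noncomputable def poissonExtC (φ : ℂ → ℂ) (z : ℂ) : ℂ :=
  if ‖z‖ < 1 then
    (1 / (2 * π) : ℝ) •
      ∫ τ in (0:ℝ)..(2 * π),
        ((1 - ‖z‖ ^ 2) / ‖Complex.exp (τ * Complex.I) - z‖ ^ 2 : ℝ) •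
          φ (Complex.exp (τ * Complex.I))
  else φ z

namespace IsMajorant

variable {ω : ℝ → ℝ}

lemma nonneg (hm : IsMajorant ω) {t : ℝ} (ht : 0 ≤ t) : 0 ≤ ω t := by
  obtain ⟨-, hmono, h0, -⟩ := hm
  simpa [h0] using hmono (Set.mem_Ici.2 le_rfl) (Set.mem_Ici.2 ht) ht

lemma mono (hm : IsMajorant ω) {s t : ℝ} (hs : 0 ≤ s) (hst : s ≤ t) : ω s ≤ ω t :=
  hm.2.1 (Set.mem_Ici.2 hs) (Set.mem_Ici.2 (hs.trans hst)) hst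

lemma div_le_div (hm : IsMajorant ω) {s t : ℝ} (hs : 0 < s) (hst : s ≤ t) :
    ω t / t ≤ ω s / s :=
  hm.2.2.2 s t hs hst

lemma apply_mul_le (hm : IsMajorant ω) {c t : ℝ} (hc : 1 ≤ c) (ht : 0 ≤ t) :
    ω (c * t) ≤ c * ω t := by
  rcases ht.eq_or_lt with rfl | ht
  · simp [hm.2.2.1]
  · have h := hm.div_le_div ht (le_mul_of_one_le_left ht.le hc)
    rw [div_le_div_iff₀ (by positivity) ht] at h
    nlinarith

/-- The integral of `ω |t| / t ^ 2`, truncated at `|t| = δ`, is controlled by `ω δ / δ`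
for a slow majorant `ω`. -/
lemma norm_integral_le_of_slow (hm : IsMajorant ω) {M : ℝ}
    (hslow : ∀ δ : ℝ, 0 < δ → δ ≤ π → δ * ∫ t in δ..π, ω t / t ^ 2 ≤ M * ω δ)
    {δ C : ℝ} (hδ : 0 < δ) (hδπ : δ ≤ π) (hC : 0 ≤ C) {G : ℝ → ℂ}
    (hG : Continuous G)
    (hnear : ∀ t, |t| ≤ δ → ‖G t‖ ≤ C * (ω δ / δ ^ 2))
    (hfar : ∀ t, δ ≤ |t| → |t| ≤ π → ‖G t‖ ≤ C * π ^ 2 * (ω |t| / t ^ 2)) :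
    ‖∫ t in (-π)..π, G t‖ ≤ C * (2 + 2 * π ^ 2 * M) * (ω δ / δ) := by
  have hint : IntervalIntegrable (fun t => C * π ^ 2 * (ω t / t ^ 2)) MeasureTheory.volume δ π := by
    refine (ContinuousOn.mul continuousOn_const (ContinuousOn.div ?_ (by fun_prop) ?_)).intervalIntegrable
    · refine hm.1.mono fun t ht => ?_
      rw [Set.uIcc_of_le hδπ] at ht
      exact hδ.le.trans ht.1
    · intro t ht
      rw [Set.uIcc_of_le hδπ] at ht
      exact pow_ne_zero _ (hδ.trans_le ht.1).ne'
  have hright : ∀ H : ℝ → ℂ, (∀ t, δ ≤ t → t ≤ π → ‖H t‖ ≤ C * π ^ 2 * (ω t / t ^ 2)) →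
      ‖∫ t in δ..π, H t‖ ≤ C * π ^ 2 * (M * (ω δ / δ)) := by
    intro H hH
    calc ‖∫ t in δ..π, H t‖ ≤ ∫ t in δ..π, C * π ^ 2 * (ω t / t ^ 2) :=
          intervalIntegral.norm_integral_le_of_norm_le hδπ
            (Filter.Eventually.of_forall fun t ht => hH t ht.1.le ht.2) hint
      _ = C * π ^ 2 * ∫ t in δ..π, ω t / t ^ 2 := intervalIntegral.integral_const_mul _ _
      _ ≤ C * π ^ 2 * (M * (ω δ / δ)) := by
          refine mul_le_mul_of_nonneg_left ?_ (by positivity)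
          rw [← mul_div_assoc, le_div_iff₀ hδ, mul_comm]
          exact hslow δ hδ hδπ
  have h1 : ‖∫ t in δ..π, G t‖ ≤ C * π ^ 2 * (M * (ω δ / δ)) := by
    refine hright G fun t ht htπ => ?_
    have ht0 : |t| = t := abs_of_pos (hδ.trans_le ht)
    simpa [ht0] using hfar t (by rwa [ht0]) (by rwa [ht0])
  have h2 : ‖∫ t in (-π)..(-δ), G t‖ ≤ C * π ^ 2 * (M * (ω δ / δ)) := by
    rw [← intervalIntegral.integral_comp_neg]
    refine hright (fun t => G (-t)) fun t ht htπ => ?_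
    have ht0 : |(-t)| = t := by rw [abs_neg]; exact abs_of_pos (hδ.trans_le ht)
    have := hfar (-t) (by rwa [ht0]) (by rwa [ht0])
    rwa [ht0, neg_sq] at this
  have h3 : ‖∫ t in (-δ)..δ, G t‖ ≤ C * 2 * (ω δ / δ) := by
    have h := intervalIntegral.norm_integral_le_of_norm_le_const (a := -δ) (b := δ) (f := G)
      (C := C * (ω δ / δ ^ 2)) fun t ht => by
        rw [Set.uIoc_of_le (by linarith)] at ht
        exact hnear t (abs_le.2 ⟨ht.1.le, ht.2⟩)
    refine h.trans_eq ?_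
    rw [abs_of_pos (by linarith)]
    field_simp
    ring
  have hi : ∀ a b : ℝ, IntervalIntegrable G MeasureTheory.volume a b := fun a b => hG.intervalIntegrable a b
  rw [← intervalIntegral.integral_add_adjacent_intervals (hi (-π) (-δ)) (hi (-δ) π),
    ← intervalIntegral.integral_add_adjacent_intervals (hi (-δ) δ) (hi δ π)]
  calc _ ≤ _ := (norm_add_le _ _).trans (add_le_add h2 ((norm_add_le _ _).trans (add_le_add h3 h1)))
    _ = _ := by ring

end IsMajorant

lemma norm_exp_add_mul_I_sub (t θ : ℝ) :
    ‖Complex.exp ((t + θ : ℝ) * Complex.I) - Complex.exp (θ * Complex.I)‖ =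
      ‖Complex.exp (Complex.I * t) - 1‖ := by
  have : Complex.exp ((t + θ : ℝ) * Complex.I) - Complex.exp (θ * Complex.I) =
      Complex.exp (θ * Complex.I) * (Complex.exp (Complex.I * t) - 1) := by
    rw [mul_sub, ← Complex.exp_add]
    push_cast
    ring_nf
  rw [this, norm_mul, Complex.norm_exp_ofReal_mul_I, one_mul]

lemma two_div_pi_mul_abs_le_norm_exp_sub_one {t : ℝ} (ht : |t| ≤ π) :
    2 / π * |t| ≤ ‖Complex.exp (Complex.I * t) - 1‖ := by
  rw [Complex.norm_exp_I_mul_ofReal_sub_one, norm_mul, Real.norm_eq_abs, Real.norm_eq_abs]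
  have h := Real.mul_abs_le_abs_sin (x := t / 2) (by rw [abs_div, abs_two]; linarith)
  rw [abs_div, abs_two] at h
  rw [abs_two]
  linarith

/-- A periodic function dominated by `ω ‖e - ζ‖ / ‖e - z‖ ^ 2` at `e = exp (τ * I)`, where `ζ` is
the point of the circle closest to `z`, has integral controlled by `ω δ / δ` with `δ = 1 - ‖z‖`. -/
lemma IsMajorant.norm_circle_integral_le {ω : ℝ → ℝ} (hm : IsMajorant ω) {M : ℝ}
    (hslow : ∀ δ : ℝ, 0 < δ → δ ≤ π → δ * ∫ t in δ..π, ω t / t ^ 2 ≤ M * ω δ)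
    {z ζ : ℂ} (hz : ‖z‖ < 1) (hζ : ‖ζ‖ = 1) (hzζ : ‖ζ - z‖ = 1 - ‖z‖) {C : ℝ} (hC : 0 ≤ C)
    {F : ℝ → ℂ} (hF : Continuous F) (hper : Function.Periodic F (2 * π))
    (hbound : ∀ τ : ℝ, ‖F τ‖ ≤ C * (ω ‖Complex.exp (τ * Complex.I) - ζ‖ /
      ‖Complex.exp (τ * Complex.I) - z‖ ^ 2)) :
    ‖∫ τ in (0:ℝ)..(2 * π), F τ‖ ≤
      C * (2 + 2 * π ^ 2 * M) * (ω (1 - ‖z‖) / (1 - ‖z‖)) := by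
  obtain ⟨θ, rfl⟩ : ∃ θ : ℝ, Complex.exp (θ * Complex.I) = ζ :=
    (Complex.norm_eq_one_iff ζ).1 hζ
  have hshift : ∫ τ in (0:ℝ)..(2 * π), F τ = ∫ t in (-π)..π, F (t + θ) := by
    rw [intervalIntegral.integral_comp_add_right]
    have := hper.intervalIntegral_add_eq 0 (-π + θ)
    rw [zero_add] at this
    rw [this]
    congr 1
    ring
  have hδ : 0 < 1 - ‖z‖ := by linarith
  have hδ1 : 1 - ‖z‖ ≤ 1 := by linarith [norm_nonneg z]
  have hdist : ∀ τ : ℝ, 1 - ‖z‖ ≤ ‖Complex.exp (τ * Complex.I) - z‖ := fun τ => by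
    have := norm_sub_norm_le (Complex.exp (τ * Complex.I)) z
    rwa [Complex.norm_exp_ofReal_mul_I] at this
  have hω : ∀ t : ℝ, ω ‖Complex.exp ((t + θ : ℝ) * Complex.I) - Complex.exp (θ * Complex.I)‖ ≤
      ω |t| := fun t => by
    rw [norm_exp_add_mul_I_sub]
    exact hm.mono (norm_nonneg _) (Real.norm_exp_I_mul_ofReal_sub_one_le)
  rw [hshift]
  refine hm.norm_integral_le_of_slow hslow hδ (by linarith [Real.pi_gt_three]) hC
    (hF.comp (by fun_prop)) (fun t ht => ?_) (fun t ht htπ => ?_)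
  · refine (hbound _).trans (mul_le_mul_of_nonneg_left ?_ hC)
    refine div_le_div₀ (hm.nonneg hδ.le) ((hω t).trans (hm.mono (abs_nonneg _) ht))
      (by positivity) ?_
    exact pow_le_pow_left₀ hδ.le (hdist _) 2
  · refine (hbound _).trans ?_
    rw [mul_assoc]
    refine mul_le_mul_of_nonneg_left ?_ hC
    have ht0 : 0 < |t| := hδ.trans_le ht
    have hlow : |t| / π ≤ ‖Complex.exp ((t + θ : ℝ) * Complex.I) - z‖ := by
      have h1 := two_div_pi_mul_abs_le_norm_exp_sub_one htπ
      rw [← norm_exp_add_mul_I_sub t θ] at h1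
      have h2 := norm_sub_le_norm_sub_add_norm_sub (Complex.exp ((t + θ : ℝ) * Complex.I)) z
        (Complex.exp (θ * Complex.I))
      have h3 := hdist (t + θ)
      rw [norm_sub_rev z] at h2
      have h4 : 2 / π * |t| = 2 * (|t| / π) := by ring
      linarith
    calc _ ≤ ω |t| / (|t| / π) ^ 2 :=
          div_le_div₀ (hm.nonneg ht0.le) (hω t) (by positivity)
            (pow_le_pow_left₀ (by positivity) hlow 2)
      _ = _ := by
          rw [div_pow, sq_abs]
          field_simp

lemma continuous_poisson_kernel {z : ℂ} (hz : ‖z‖ < 1) :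
    Continuous fun τ : ℝ => (1 - ‖z‖ ^ 2) / ‖Complex.exp (τ * Complex.I) - z‖ ^ 2 := by
  refine Continuous.div (by fun_prop) (by fun_prop) fun τ => ?_
  have := norm_sub_norm_le (Complex.exp (τ * Complex.I)) z
  rw [Complex.norm_exp_ofReal_mul_I] at this
  exact pow_ne_zero _ (by linarith)

lemma integral_poisson_kernel {z : ℂ} (hz : ‖z‖ < 1) :
    ∫ τ in (0:ℝ)..(2 * π), (1 - ‖z‖ ^ 2) / ‖Complex.exp (τ * Complex.I) - z‖ ^ 2 = 2 * π := by
  have h := (diffContOnCl_const (c := (1 : ℂ)) (s := ball (0 : ℂ) 1) (𝕜 := ℂ)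
    ).circleAverage_poissonKernel_smul' (w := z) (by simpa using hz)
  simp only [Real.circleAverage, circleMap_zero, sub_zero, Complex.ofReal_one, one_mul,
    Complex.norm_exp_ofReal_mul_I, one_pow, intervalIntegral.integral_smul_const,
    smul_smul] at h
  rw [Complex.real_smul, mul_one, Complex.ofReal_eq_one, inv_mul_eq_one₀ (by positivity)] at h
  exact h.symm

lemma poissonExtC_sub_const {φ : ℂ → ℂ} (hφ : Continuous fun τ : ℝ => φ (Complex.exp (τ * Complex.I)))
    {z : ℂ} (hz : ‖z‖ < 1) (c : ℂ) :
    poissonExtC φ z - c = (1 / (2 * π) : ℝ) • ∫ τ in (0:ℝ)..(2 * π),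
      ((1 - ‖z‖ ^ 2) / ‖Complex.exp (τ * Complex.I) - z‖ ^ 2 : ℝ) •
        (φ (Complex.exp (τ * Complex.I)) - c) := by
  have hk := continuous_poisson_kernel hz
  simp_rw [smul_sub]
  rw [intervalIntegral.integral_sub ((hk.fun_smul hφ).intervalIntegrable _ _)
    ((hk.fun_smul continuous_const).intervalIntegrable _ _), intervalIntegral.integral_smul_const,
    integral_poisson_kernel hz, smul_sub, smul_smul, poissonExtC, if_pos hz]
  rw [one_div_mul_cancel (by positivity), one_smul]

lemma abs_poisson_kernel_sub_le {e z w : ℂ} (he : ‖e‖ = 1) (hz : ‖z‖ < 1) (hw : ‖w‖ < 1)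
    (hzw : ‖z - w‖ ≤ (1 - ‖z‖) / 2) :
    |(1 - ‖z‖ ^ 2) / ‖e - z‖ ^ 2 - (1 - ‖w‖ ^ 2) / ‖e - w‖ ^ 2| ≤
      8 * ‖z - w‖ / ‖e - z‖ ^ 2 := by
  have hz1 := norm_sub_norm_le e z
  have hw1 := norm_sub_norm_le e w
  have h1 := abs_le.1 (abs_norm_sub_norm_le z w)
  have h2 := abs_le.1 (abs_norm_sub_norm_le (e - z) (e - w))
  rw [show e - z - (e - w) = -(z - w) by ring, norm_neg] at h2
  rw [he] at hz1 hw1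
  have hz0 := norm_nonneg z
  have hw0 := norm_nonneg w
  set a := ‖e - z‖
  set b := ‖e - w‖
  set d := ‖z - w‖
  set r := ‖z‖
  set s := ‖w‖
  have ha : 0 < a := by linarith
  have hb : 0 < b := by linarith
  have hd : 0 ≤ d := norm_nonneg _
  have hab : a ≤ 2 * b := by linarith
  have e1 : (1 - r ^ 2) / a ^ 2 - (1 - s ^ 2) / b ^ 2 =
      ((s ^ 2 - r ^ 2) + (1 - s ^ 2) * (b - a) * (a + b) / b ^ 2) / a ^ 2 := by
    field_simp
    ring
  rw [e1, abs_div, abs_of_pos (pow_pos ha 2)]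
  refine div_le_div_of_nonneg_right ?_ (by positivity)
  have t1 : |s ^ 2 - r ^ 2| ≤ 2 * d := by
    rw [abs_le]; constructor <;> nlinarith
  have t2 : |(1 - s ^ 2) * (b - a) * (a + b) / b ^ 2| ≤ 6 * d := by
    rw [abs_div, abs_of_pos (pow_pos hb 2), div_le_iff₀ (pow_pos hb 2), abs_mul, abs_mul,
      abs_of_pos (add_pos ha hb), abs_of_nonneg (by nlinarith : 0 ≤ 1 - s ^ 2)]
    calc (1 - s ^ 2) * |b - a| * (a + b) ≤ (2 * b) * d * (3 * b) := by
          have u1 : 1 - s ^ 2 ≤ 2 * b := by nlinarith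
          have u2 : |b - a| ≤ d := abs_le.2 ⟨by linarith, by linarith⟩
          have u3 : a + b ≤ 3 * b := by linarith
          gcongr
      _ = 6 * d * b ^ 2 := by ring
  linarith [abs_add_le (s ^ 2 - r ^ 2) ((1 - s ^ 2) * (b - a) * (a + b) / b ^ 2)]

lemma exists_norm_eq_one_norm_sub_eq {z : ℂ} (hz : ‖z‖ ≤ 1) :
    ∃ ζ : ℂ, ‖ζ‖ = 1 ∧ ‖ζ - z‖ = 1 - ‖z‖ := by
  rcases eq_or_ne z 0 with rfl | h0
  · exact ⟨1, by simp⟩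
  · have hp : 0 < ‖z‖ := norm_pos_iff.2 h0
    refine ⟨(‖z‖⁻¹ : ℝ) • z, ?_, ?_⟩
    · rw [norm_smul, norm_inv, norm_norm, inv_mul_cancel₀ hp.ne']
    · have : (‖z‖⁻¹ : ℝ) • z - z = (‖z‖⁻¹ - 1 : ℝ) • z := by rw [sub_smul, one_smul]
      rw [this, norm_smul, Real.norm_eq_abs,
        abs_of_nonneg (sub_nonneg.2 ((one_le_inv₀ hp).2 hz)), sub_mul, inv_mul_cancel₀ hp.ne',
        one_mul]

lemma norm_one_div_two_pi_smul_le (x : ℂ) : ‖(1 / (2 * π) : ℝ) • x‖ ≤ ‖x‖ := by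
  rw [norm_smul, Real.norm_eq_abs, abs_of_pos (by positivity)]
  refine mul_le_of_le_one_left (norm_nonneg _) ?_
  rw [div_le_one (by positivity)]
  linarith [Real.pi_gt_three]

theorem stmt14 (ω : ℝ → ℝ) (hm : IsMajorant ω)
    (M : ℝ) (hM : 0 < M)
    (hslow : ∀ δ : ℝ, 0 < δ → δ ≤ π → δ * ∫ t in δ..π, ω t / t ^ 2 ≤ M * ω δ)
    (φ : ℂ → ℂ) (hcont : ContinuousOn φ (sphere (0:ℂ) 1))
    (L : ℝ) (hL : 0 < L)
    (hlip : ∀ ξ₁ ∈ sphere (0:ℂ) 1, ∀ ξ₂ ∈ sphere (0:ℂ) 1,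
      ‖φ ξ₁ - φ ξ₂‖ ≤ L * ω ‖ξ₁ - ξ₂‖) :
    ∃ M' > (0:ℝ), ∀ z₁ ∈ closedBall (0:ℂ) 1, ∀ z₂ ∈ closedBall (0:ℂ) 1,
      ‖poissonExtC φ z₁ - poissonExtC φ z₂‖ ≤ M' * ω ‖z₁ - z₂‖ := by
  simp only [mem_sphere_zero_iff_norm, mem_closedBall_zero_iff] at hlip ⊢
  have hφ : Continuous fun τ : ℝ => φ (Complex.exp (τ * Complex.I)) :=
    hcont.comp_continuous (by fun_prop) fun τ => by simp [Complex.norm_exp_ofReal_mul_I]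
  have hexp : ∀ τ : ℝ, Complex.exp ((τ + 2 * π : ℝ) * Complex.I) = Complex.exp (τ * Complex.I) := by
    intro τ
    push_cast
    rw [add_mul, Complex.exp_periodic]
  set A := 2 + 2 * π ^ 2 * M with hA
  have hA0 : 0 < A := by positivity
  have hradial : ∀ z : ℂ, ‖z‖ ≤ 1 → ∃ ζ : ℂ, ‖ζ‖ = 1 ∧ ‖ζ - z‖ = 1 - ‖z‖ ∧
      ‖poissonExtC φ z - φ ζ‖ ≤ 2 * L * A * ω (1 - ‖z‖) := by
    intro z hz
    rcases hz.eq_or_lt with h1 | h1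
    · exact ⟨z, h1, by simp [h1], by simp [poissonExtC, h1, hm.2.2.1]⟩
    obtain ⟨ζ, hζ, hzζ⟩ := exists_norm_eq_one_norm_sub_eq hz
    refine ⟨ζ, hζ, hzζ, ?_⟩
    have hδ : 0 < 1 - ‖z‖ := by linarith
    rw [poissonExtC_sub_const hφ h1]
    refine (norm_one_div_two_pi_smul_le _).trans ?_
    refine (hm.norm_circle_integral_le hslow h1 hζ hzζ (C := 2 * (1 - ‖z‖) * L) (by positivity)
      ((continuous_poisson_kernel h1).fun_smul (hφ.fun_sub continuous_const))
      (fun τ => by simp only [hexp]) fun τ => ?_).trans_eq ?_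
    · rw [norm_smul, Real.norm_eq_abs,
        abs_of_nonneg (div_nonneg (by nlinarith [norm_nonneg z]) (by positivity)), div_mul_eq_mul_div,
        ← mul_div_assoc]
      refine div_le_div_of_nonneg_right ?_ (by positivity)
      have h2 := hlip _ (Complex.norm_exp_ofReal_mul_I τ) ζ hζ
      rw [mul_assoc (2 * (1 - ‖z‖))]
      exact mul_le_mul (by nlinarith [norm_nonneg z]) h2 (norm_nonneg _) (by positivity)
    · rw [hA]
      field_simp
  have hclose : ∀ z w : ℂ, ‖z‖ ≤ 1 → ‖w‖ ≤ 1 → z ≠ w → ‖z - w‖ ≤ (1 - ‖z‖) / 2 →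
      ‖poissonExtC φ z - poissonExtC φ w‖ ≤ 8 * L * A * ω ‖z - w‖ := by
    intro z w hz hw hne hzw
    have hd : 0 < ‖z - w‖ := norm_pos_iff.2 (sub_ne_zero.2 hne)
    have h1 : ‖z‖ < 1 := by linarith
    have h2 : ‖w‖ < 1 := by linarith [norm_sub_norm_le w z, norm_sub_rev z w]
    obtain ⟨ζ, hζ, hzζ⟩ := exists_norm_eq_one_norm_sub_eq hz
    have hkz := continuous_poisson_kernel h1
    have hkw := continuous_poisson_kernel h2
    have hφζ := hφ.fun_sub (continuous_const (y := φ ζ))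
    rw [← sub_sub_sub_cancel_right _ _ (φ ζ), poissonExtC_sub_const hφ h1,
      poissonExtC_sub_const hφ h2, ← smul_sub, ← intervalIntegral.integral_sub
      ((hkz.fun_smul hφζ).intervalIntegrable _ _) ((hkw.fun_smul hφζ).intervalIntegrable _ _)]
    simp_rw [← sub_smul]
    refine (norm_one_div_two_pi_smul_le _).trans ?_
    refine (hm.norm_circle_integral_le hslow h1 hζ hzζ (C := 8 * ‖z - w‖ * L) (by positivity)
      ((hkz.fun_sub hkw).fun_smul hφζ) (fun τ => by simp only [hexp]) fun τ => ?_).trans ?_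
    · have h3 := hlip _ (Complex.norm_exp_ofReal_mul_I τ) ζ hζ
      have h4 := abs_poisson_kernel_sub_le (Complex.norm_exp_ofReal_mul_I τ) h1 h2 hzw
      rw [norm_smul, Real.norm_eq_abs]
      refine (mul_le_mul h4 h3 (norm_nonneg _) (by positivity)).trans_eq ?_
      ring
    · have h5 := hm.div_le_div hd (hzw.trans (by linarith : (1 - ‖z‖) / 2 ≤ 1 - ‖z‖))
      refine (mul_le_mul_of_nonneg_left h5 (by positivity)).trans_eq ?_
      rw [hA]
      field_simp
  refine ⟨8 * L * A + 5 * L, by positivity, fun z hz w hw => ?_⟩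
  have hω := hm.nonneg (norm_nonneg (z - w))
  rcases eq_or_ne z w with rfl | hne
  · simp [hm.2.2.1]
  rcases le_or_gt ‖z - w‖ ((1 - ‖z‖) / 2) with hzw | hzw
  · nlinarith [hclose z w hz hw hne hzw, mul_nonneg hL.le hω]
  rcases le_or_gt ‖z - w‖ ((1 - ‖w‖) / 2) with hwz | hwz
  · have := hclose w z hw hz hne.symm (by rwa [norm_sub_rev])
    rw [norm_sub_rev, norm_sub_rev w z] at this
    nlinarith [mul_nonneg hL.le hω]
  obtain ⟨ζ, hζ, hzζ, hu⟩ := hradial z hz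
  obtain ⟨η, hη, hwη, hv⟩ := hradial w hw
  have hLA : 0 ≤ 2 * L * A := by positivity
  have b1 : ω (1 - ‖z‖) ≤ 2 * ω ‖z - w‖ :=
    (hm.mono (by linarith) (by linarith)).trans (hm.apply_mul_le one_le_two (norm_nonneg _))
  have b2 : ω (1 - ‖w‖) ≤ 2 * ω ‖z - w‖ :=
    (hm.mono (by linarith) (by linarith)).trans (hm.apply_mul_le one_le_two (norm_nonneg _))
  have b3 : ‖ζ - η‖ ≤ 5 * ‖z - w‖ := by
    have h1 := norm_add₃_le (a := ζ - z) (b := z - w) (c := w - η)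
    rw [show ζ - z + (z - w) + (w - η) = ζ - η by ring, norm_sub_rev w η] at h1
    linarith
  have b4 : ‖φ ζ - φ η‖ ≤ L * (5 * ω ‖z - w‖) :=
    (hlip ζ hζ η hη).trans (mul_le_mul_of_nonneg_left
      ((hm.mono (norm_nonneg _) b3).trans (hm.apply_mul_le (by norm_num) (norm_nonneg _))) hL.le)
  have b5 := norm_add₃_le (a := poissonExtC φ z - φ ζ) (b := φ ζ - φ η) (c := φ η - poissonExtC φ w)
  rw [show poissonExtC φ z - φ ζ + (φ ζ - φ η) + (φ η - poissonExtC φ w) =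
    poissonExtC φ z - poissonExtC φ w by ring, norm_sub_rev (φ η)] at b5
  nlinarith [mul_le_mul_of_nonneg_left b1 hLA, mul_le_mul_of_nonneg_left b2 hLA]
end
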